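/- Fix m, K, d ≥ 1. Let H_i : ℝᵐ × ℝᵐ → ℝ (i = 1,…,K) and μ_a : ℝᵐ × ℝᵐ → ℝ (a = 1,…,d) be continuously differentiable functions of (p, q) such that {H_i, μ_a} = 0 identically for all i, a. Suppose differentiable maps p, q : ℝᴷ → ℝᵐ and functions Ã^a_i : ℝᴷ → ℝ satisfy, for all i, μ and t ∈ ℝᴷ, the constrained Hamiltonian equations ∂q^μ/∂t^i = (∂H_i/∂p_μ)(p(t),q(t)) − Σ_a Ã^a_i(t) (∂μ_a/∂p_μ)(p(t),q(t)) and ∂p_μ/∂t^i = −(∂H_i/∂q^μ)(p(t),q(t)) + Σ_a Ã^a_i(t) (∂μ_a/∂q^μ)(p(t),q(t)), together with the closure equations Σ_{μ=1}^m [(∂H_i/∂p_μ)(p(t),q(t)) ∂p_μ/∂t^j + (∂H_i/∂q^μ)(p(t),q(t)) ∂q^μ/∂t^j] = 0 for all i, j. Then the Hamiltonians Poisson-commute along the solution: {H_i, H_j}(p(t), q(t)) = 0 for all i, j ∈ {1,…,K} and all t ∈ ℝᴷ. -/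

import Mathlib

/-- If each pairing `∑ μ, (x μ * v a μ - y μ * u a μ)` vanishes, and so does the pairing of `(x, y)`
with `(z, w)` shifted by a combination of the `(u a, v a)`, then `(x, y)` and `(z, w)` pair to
zero. -/
theorem sum_mul_sub_mul_eq_zero_of_shift {ι κ R : Type*} [Fintype ι] [Fintype κ] [CommRing R]
    (x y z w : ι → R) (u v : κ → ι → R) (c : κ → R)
    (h : ∀ a, ∑ μ, (x μ * v a μ - y μ * u a μ) = 0)
    (hc : ∑ μ, (x μ * (-w μ + ∑ a, c a * v a μ) + y μ * (z μ - ∑ a, c a * u a μ)) = 0) :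
    ∑ μ, (x μ * w μ - y μ * z μ) = 0 := by
  have h0 : ∑ μ, (x μ * ∑ a, c a * v a μ - y μ * ∑ a, c a * u a μ) = 0 := by
    calc
      _ = ∑ μ, ∑ a, c a * (x μ * v a μ - y μ * u a μ) := by
        refine Finset.sum_congr rfl fun μ _ => ?_
        rw [Finset.mul_sum, Finset.mul_sum, ← Finset.sum_sub_distrib]
        exact Finset.sum_congr rfl fun a _ => by ring
      _ = ∑ a, c a * ∑ μ, (x μ * v a μ - y μ * u a μ) := by
        rw [Finset.sum_comm]
        simp only [Finset.mul_sum]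
      _ = 0 := by simp [h]
  rw [← sub_zero (0 : R)]
  nth_rewrite 1 [← h0]
  rw [← hc, ← Finset.sum_sub_distrib]
  exact Finset.sum_congr rfl fun μ _ => by ring


/-- If constrained Hamiltonian equations together with the closure equations hold along a
multitime solution `(p(t), q(t))`, and the Hamiltonians `H_i` canonically Poisson-commute
with the constraints `μ_a`, then the Hamiltonians Poisson-commute along the solution. -/
theorem statement9 (m K d : ℕ) (hm : 1 ≤ m) (hK : 1 ≤ K) (hd : 1 ≤ d)
    (H : Fin K → ((Fin m → ℝ) × (Fin m → ℝ)) → ℝ)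
    (μc : Fin d → ((Fin m → ℝ) × (Fin m → ℝ)) → ℝ)
    (hH : ∀ i, ContDiff ℝ 1 (H i)) (hμc : ∀ a, ContDiff ℝ 1 (μc a))
    (hHμ : ∀ (i : Fin K) (a : Fin d) (x : (Fin m → ℝ) × (Fin m → ℝ)),
      (∑ μ, (fderiv ℝ (H i) x (Pi.single μ 1, 0) * fderiv ℝ (μc a) x (0, Pi.single μ 1)
        - fderiv ℝ (H i) x (0, Pi.single μ 1) * fderiv ℝ (μc a) x (Pi.single μ 1, 0))) = 0)
    (p q : (Fin K → ℝ) → (Fin m → ℝ))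
    (hp : Differentiable ℝ p) (hq : Differentiable ℝ q)
    (A : Fin d → Fin K → (Fin K → ℝ) → ℝ)
    (heqq : ∀ (i : Fin K) (μ : Fin m) (t : Fin K → ℝ),
      fderiv ℝ q t (Pi.single i 1) μ
        = fderiv ℝ (H i) (p t, q t) (Pi.single μ 1, 0)
          - ∑ a, A a i t * fderiv ℝ (μc a) (p t, q t) (Pi.single μ 1, 0))
    (heqp : ∀ (i : Fin K) (μ : Fin m) (t : Fin K → ℝ),
      fderiv ℝ p t (Pi.single i 1) μ
        = -fderiv ℝ (H i) (p t, q t) (0, Pi.single μ 1)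
          + ∑ a, A a i t * fderiv ℝ (μc a) (p t, q t) (0, Pi.single μ 1))
    (hclosure : ∀ (i j : Fin K) (t : Fin K → ℝ),
      (∑ μ, (fderiv ℝ (H i) (p t, q t) (Pi.single μ 1, 0) * fderiv ℝ p t (Pi.single j 1) μ
        + fderiv ℝ (H i) (p t, q t) (0, Pi.single μ 1) * fderiv ℝ q t (Pi.single j 1) μ)) = 0) :
    ∀ (i j : Fin K) (t : Fin K → ℝ),
      (∑ μ, (fderiv ℝ (H i) (p t, q t) (Pi.single μ 1, 0)
            * fderiv ℝ (H j) (p t, q t) (0, Pi.single μ 1)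
          - fderiv ℝ (H i) (p t, q t) (0, Pi.single μ 1)
            * fderiv ℝ (H j) (p t, q t) (Pi.single μ 1, 0))) = 0 := by
  intro i j t
  have hc := hclosure i j t
  simp only [heqq, heqp] at hc
  exact sum_mul_sub_mul_eq_zero_of_shift _ _ _ _ _ _ (fun a => A a j t)
    (fun a => hHμ i a (p t, q t)) hc
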